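/- Fix α ∈ (0, 1/2). If a solution (h, a) of the limiting system with the constraint satisfies h(x₀) = 0 and h′(x₀) = 0 at some x₀ > 0 (whence a(x₀) = 1 − 2α by the constraint), then h ≡ 0 and a ≡ 1 − 2α on its whole interval of definition. Consequently, for a solution with the initial conditions h(0) = −π/2, h′(0) = 1, a(0) = 1 there is no x₀ > 0 with h(x₀) = h′(x₀) = 0, so the rotation function θ(x) defined by tan θ(x) = x h′(x)/h(x), θ(0) = 0, is well defined. -/

import Mathlib

open Real Filter Set Topology

noncomputable section

/-- The limiting system (the `c → ∞` rescaling limit of the CSS system) for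
`(h, a)` with derivative function `h'` for `h`, on a set `s ⊆ (0, ∞)`,
together with the constraint. -/
def LimSys (α : ℝ) (h h' a : ℝ → ℝ) (s : Set ℝ) : Prop :=
  ∀ x ∈ s,
    HasDerivAt h (h' x) x ∧
    HasDerivAt h' (α * x * h' x ^ 3 - (2 / x) * h' x
        - Real.sin (2 * h x) / (a x * x ^ 2)) x ∧
    HasDerivAt a (-2 * α * x * a x * h' x ^ 2) x ∧
    1 - 2 * α - a x + 2 * α * Real.sin (h x) ^ 2 + α * a x * x ^ 2 * h' x ^ 2 = 0

/-- The initial conditions `h(0) = -π/2`, `h'(0) = 1`, `a(0) = 1` at the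
singular point `x = 0`, understood as limits as `x → 0⁺`. -/
def LimIC (h h' a : ℝ → ℝ) : Prop :=
  Filter.Tendsto h (𝓝[>] 0) (𝓝 (-(π / 2))) ∧
  Filter.Tendsto h' (𝓝[>] 0) (𝓝 1) ∧
  Filter.Tendsto a (𝓝[>] 0) (𝓝 1)

/-- A function with `|E'| ≤ K |E|` on the segment from `x₀` to `x` that vanishes at `x₀` vanishes
at `x`. -/
theorem eq_zero_of_abs_deriv_le_mul_abs_on_uIcc {E E' : ℝ → ℝ} {K x₀ x : ℝ}
    (hE : ∀ t ∈ uIcc x₀ x, HasDerivAt E (E' t) t)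
    (hK : ∀ t ∈ uIcc x₀ x, |E' t| ≤ K * |E t|) (h0 : E x₀ = 0) : E x = 0 := by
  have forward : ∀ {F F' : ℝ → ℝ} {u v : ℝ}, u ≤ v →
      (∀ t ∈ Icc u v, HasDerivAt F (F' t) t) →
      (∀ t ∈ Icc u v, |F' t| ≤ K * |F t|) → F u = 0 → F v = 0 := by
    intro F F' u v huv hF hFK hFu
    exact eq_zero_of_abs_deriv_le_mul_abs_self_of_eq_zero_right
      (fun t ht => (hF t ht).continuousAt.continuousWithinAt)
      (fun t ht => (hF t (Ico_subset_Icc_self ht)).hasDerivWithinAt) hFu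
      (fun t ht => hFK t (Ico_subset_Icc_self ht)) v (right_mem_Icc.2 huv)
  rcases le_total x₀ x with hx | hx
  · rw [uIcc_of_le hx] at hE hK
    exact forward hx hE hK h0
  · rw [uIcc_of_ge hx] at hE hK
    have hmem : ∀ t ∈ Icc (-x₀) (-x), -t ∈ Icc x x₀ := fun t ht =>
      ⟨by linarith [ht.2], by linarith [ht.1]⟩
    have key := forward (F := fun t => E (-t)) (F' := fun t => -E' (-t)) (neg_le_neg hx)
      (fun t ht => by
        simpa [Function.comp_def] using (hE (-t) (hmem t ht)).scomp t (hasDerivAt_neg t))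
      (fun t ht => by simpa using hK (-t) (hmem t ht)) (by simpa using h0)
    simpa using key

/-- The constraint forces `a` to be nonzero. -/
theorem LimSys.a_ne_zero {α : ℝ} {h h' a : ℝ → ℝ} {s : Set ℝ} (hS : LimSys α h h' a s)
    (hα0 : 0 < α) (hα : α < 1 / 2) {x : ℝ} (hx : x ∈ s) : a x ≠ 0 := by
  intro h0
  have hc := (hS x hx).2.2.2
  rw [h0] at hc
  have := mul_nonneg hα0.le (sq_nonneg (Real.sin (h x)))
  linarith

/-- A solution of the limiting system with `h(x₀) = h'(x₀) = 0` is constant. -/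
theorem LimSys.eq_const {α : ℝ} {h h' a : ℝ → ℝ} {s : Set ℝ} (hS : LimSys α h h' a s)
    (hα0 : 0 < α) (hα : α < 1 / 2) (hs : s.OrdConnected) (hpos : s ⊆ Ioi 0)
    {x₀ : ℝ} (hx₀ : x₀ ∈ s) (h0 : h x₀ = 0) (h0' : h' x₀ = 0) {x : ℝ} (hx : x ∈ s) :
    h x = 0 ∧ a x = 1 - 2 * α := by
  have hsub : uIcc x₀ x ⊆ s := hs.uIcc_subset hx₀ hx
  have hx0 : ∀ t ∈ uIcc x₀ x, t ≠ 0 := fun t ht => (hpos (hsub ht)).ne'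
  have ha0 : ∀ t ∈ uIcc x₀ x, a t ≠ 0 := fun t ht => hS.a_ne_zero hα0 hα (hsub ht)
  have hc' : ContinuousOn h' (uIcc x₀ x) := fun t ht =>
    (hS t (hsub ht)).2.1.continuousAt.continuousWithinAt
  have hca : ContinuousOn a (uIcc x₀ x) := fun t ht =>
    (hS t (hsub ht)).2.2.1.continuousAt.continuousWithinAt
  have hc₁ : ContinuousOn (fun t => 2 * α * t * h' t ^ 2 - 4 / t) (uIcc x₀ x) :=
    ((continuousOn_const.mul continuousOn_id).mul (hc'.pow 2)).sub
      (continuousOn_const.div continuousOn_id hx0)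
  have hc₂ : ContinuousOn (fun t => 1 / (a t * t ^ 2)) (uIcc x₀ x) :=
    continuousOn_const.div (hca.mul (continuousOn_id.pow 2))
      fun t ht => mul_ne_zero (ha0 t ht) (pow_ne_zero 2 (hx0 t ht))
  obtain ⟨C₁, hC₁⟩ := isCompact_uIcc.exists_bound_of_continuousOn hc₁
  obtain ⟨C₂, hC₂⟩ := isCompact_uIcc.exists_bound_of_continuousOn hc₂
  have key := eq_zero_of_abs_deriv_le_mul_abs_on_uIcc (E := fun t => h t ^ 2 + h' t ^ 2)
    (E' := fun t => 2 * h t * h' t + (2 * α * t * h' t ^ 2 - 4 / t) * h' t ^ 2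
      - 2 * (h' t * Real.sin (2 * h t)) * (1 / (a t * t ^ 2)))
    (K := 1 + C₁ + 2 * C₂) (x₀ := x₀) (x := x)
    (fun t ht => by
      obtain ⟨d, d', -, -⟩ := hS t (hsub ht)
      refine ((d.pow 2).add (d'.pow 2)).congr_deriv ?_
      push_cast
      ring)
    (fun t ht => by
      have b₁ := hC₁ t ht
      have b₂ := hC₂ t ht
      rw [Real.norm_eq_abs] at b₁ b₂
      have hsin : |Real.sin (2 * h t)| ≤ 2 * |h t| := by
        simpa [abs_mul] using Real.abs_sin_le_abs (x := 2 * h t)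
      have hprod : 2 * (|h t| * |h' t|) ≤ h t ^ 2 + h' t ^ 2 := by
        have := two_mul_le_add_sq |h t| |h' t|
        simp only [sq_abs] at this
        linarith
      have t₁ : |2 * h t * h' t| ≤ h t ^ 2 + h' t ^ 2 := by
        simpa [abs_mul, mul_assoc] using hprod
      have t₂ : |(2 * α * t * h' t ^ 2 - 4 / t) * h' t ^ 2| ≤ C₁ * (h t ^ 2 + h' t ^ 2) := by
        rw [abs_mul, abs_of_nonneg (sq_nonneg (h' t))]
        exact mul_le_mul b₁ (by nlinarith) (sq_nonneg _) ((abs_nonneg _).trans b₁)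
      have t₃ : |2 * (h' t * Real.sin (2 * h t)) * (1 / (a t * t ^ 2))|
          ≤ 2 * (h t ^ 2 + h' t ^ 2) * C₂ := by
        rw [abs_mul]
        refine mul_le_mul ?_ b₂ (abs_nonneg _) (by positivity)
        rw [abs_mul, abs_mul, abs_two]
        have := mul_le_mul_of_nonneg_left hsin (abs_nonneg (h' t))
        linarith
      rw [abs_of_nonneg (by positivity : 0 ≤ h t ^ 2 + h' t ^ 2)]
      refine (abs_sub _ _).trans ?_
      linarith [abs_add_le (2 * h t * h' t) ((2 * α * t * h' t ^ 2 - 4 / t) * h' t ^ 2)])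
    (by simp [h0, h0'])
  have hh : h x = 0 := by nlinarith [sq_nonneg (h x), sq_nonneg (h' x)]
  have hh' : h' x = 0 := by nlinarith [sq_nonneg (h x), sq_nonneg (h' x)]
  have hc := (hS x hx).2.2.2
  simp only [hh, hh', Real.sin_zero] at hc
  exact ⟨hh, by linarith⟩

/-- Rigidity (Remark 1): if a solution of the limiting system has
`h(x₀) = h'(x₀) = 0` at some `x₀ > 0`, then `a(x₀) = 1 - 2α` and the solution
is identically `h ≡ 0`, `a ≡ 1 - 2α` on its whole interval of definition.
Consequently, for a solution with the initial conditions `h(0) = -π/2`,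
`h'(0) = 1`, `a(0) = 1` there is no `x₀ > 0` with `h(x₀) = h'(x₀) = 0`, so the
rotation function `θ` with `tan θ(x) = x h'(x) / h(x)` is well defined. -/
theorem limiting_system_rigidity (α : ℝ) (hα0 : 0 < α) (hα : α < 1 / 2) :
    (∀ (h h' a : ℝ → ℝ) (s : Set ℝ), s.OrdConnected → s ⊆ Set.Ioi 0 →
      LimSys α h h' a s → ∀ x₀ ∈ s, h x₀ = 0 → h' x₀ = 0 →
      a x₀ = 1 - 2 * α ∧ ∀ x ∈ s, h x = 0 ∧ a x = 1 - 2 * α) ∧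
    (∀ h h' a : ℝ → ℝ,
      LimSys α h h' a (Set.Ioi 0) → LimIC h h' a →
      ∀ x₀, 0 < x₀ → ¬ (h x₀ = 0 ∧ h' x₀ = 0)) := by
  refine ⟨fun h h' a s hs hpos hS x₀ hx₀ h0 h0' =>
    ⟨(hS.eq_const hα0 hα hs hpos hx₀ h0 h0' hx₀).2,
      fun x hx => hS.eq_const hα0 hα hs hpos hx₀ h0 h0' hx⟩, ?_⟩
  rintro h h' a hS ⟨hlim, -, -⟩ x₀ hx₀ ⟨h0, h0'⟩
  have hzero : h =ᶠ[𝓝[>] 0] fun _ => 0 := by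
    filter_upwards [self_mem_nhdsWithin] with x hx
    exact (hS.eq_const hα0 hα ordConnected_Ioi subset_rfl hx₀ h0 h0' hx).1
  have := tendsto_nhds_unique (hlim.congr' hzero) tendsto_const_nhds
  linarith [Real.pi_pos]
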